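/- In the setting P = F h^{-1} F* with F holomorphic and h = F*F invertible, and with curvature K_P = −∂̄(h^{-1}∂h), one has (∂̄²P)·(∂P) = F·(−∂̄K_P)·h^{-1}·F* on Ω. -/

import Mathlib

open Complex ContinuousLinearMap

/-- Wirtinger derivative ∂ = ∂/∂λ. -/
noncomputable def pd {E : Type*} [NormedAddCommGroup E] [NormedSpace ℂ E]
    (f : ℂ → E) : ℂ → E :=
  fun z => (2⁻¹ : ℂ) • (fderiv ℝ f z 1 - Complex.I • fderiv ℝ f z Complex.I)

/-- Wirtinger derivative ∂̄ = ∂/∂λ̄. -/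
noncomputable def pdbar {E : Type*} [NormedAddCommGroup E] [NormedSpace ℂ E]
    (f : ℂ → E) : ℂ → E :=
  fun z => (2⁻¹ : ℂ) • (fderiv ℝ f z 1 + Complex.I • fderiv ℝ f z Complex.I)

section Wirtinger

variable {E G X : Type*} [NormedAddCommGroup E] [NormedSpace ℂ E]
  [NormedAddCommGroup G] [NormedSpace ℂ G] [NormedAddCommGroup X] [NormedSpace ℂ X]

theorem pd_congr {f g : ℂ → E} {z : ℂ} (hfg : f =ᶠ[nhds z] g) : pd f z = pd g z := by
  simp only [pd, hfg.fderiv_eq]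

theorem pdbar_congr {f g : ℂ → E} {z : ℂ} (hfg : f =ᶠ[nhds z] g) :
    pdbar f z = pdbar g z := by
  simp only [pdbar, hfg.fderiv_eq]

theorem pdbar_const (c : E) (z : ℂ) : pdbar (fun _ => c) z = 0 := by
  simp [pdbar]

theorem pdbar_neg (f : ℂ → E) (z : ℂ) : pdbar (fun w => -f w) z = -pdbar f z := by
  simp only [pdbar, fderiv_fun_neg, neg_apply]
  module

theorem hasFDerivAt_comp_restrictScalars {f : ℂ → G →L[ℂ] X} {g : ℂ → E →L[ℂ] G} {z : ℂ}
    (hf : DifferentiableAt ℝ f z) (hg : DifferentiableAt ℝ g z) :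
    ∃ L : ℂ →L[ℝ] (E →L[ℂ] X), HasFDerivAt (fun w => f w ∘L g w) L z ∧
      ∀ v, L v = f z ∘L fderiv ℝ g z v + fderiv ℝ f z v ∘L g z :=
  ⟨_, ((compL ℂ E G X).bilinearRestrictScalars ℝ).hasFDerivAt_of_bilinear
    hf.hasFDerivAt hg.hasFDerivAt, fun _ => rfl⟩

theorem pd_comp {f : ℂ → G →L[ℂ] X} {g : ℂ → E →L[ℂ] G} {z : ℂ}
    (hf : DifferentiableAt ℝ f z) (hg : DifferentiableAt ℝ g z) :
    pd (fun w => f w ∘L g w) z = pd f z ∘L g z + f z ∘L pd g z := by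
  obtain ⟨L, hL, hv⟩ := hasFDerivAt_comp_restrictScalars hf hg
  simp only [pd, hL.fderiv, hv, smul_comp, comp_smul, sub_comp, comp_sub]
  module

theorem pdbar_comp {f : ℂ → G →L[ℂ] X} {g : ℂ → E →L[ℂ] G} {z : ℂ}
    (hf : DifferentiableAt ℝ f z) (hg : DifferentiableAt ℝ g z) :
    pdbar (fun w => f w ∘L g w) z = pdbar f z ∘L g z + f z ∘L pdbar g z := by
  obtain ⟨L, hL, hv⟩ := hasFDerivAt_comp_restrictScalars hf hg
  simp only [pdbar, hL.fderiv, hv, smul_comp, comp_smul, add_comp, comp_add]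
  module

theorem fderiv_real_apply_of_differentiableAt {f : ℂ → E} {z : ℂ}
    (hf : DifferentiableAt ℂ f z) (v : ℂ) : fderiv ℝ f z v = v • deriv f z := by
  rw [(hf.hasFDerivAt.restrictScalars ℝ).fderiv]
  simp

theorem pd_eq_deriv {f : ℂ → E} {z : ℂ} (hf : DifferentiableAt ℂ f z) :
    pd f z = deriv f z := by
  simp only [pd, fderiv_real_apply_of_differentiableAt hf, smul_smul, I_mul_I]
  module

theorem pdbar_eq_zero {f : ℂ → E} {z : ℂ} (hf : DifferentiableAt ℂ f z) :
    pdbar f z = 0 := by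
  simp only [pdbar, fderiv_real_apply_of_differentiableAt hf, smul_smul, I_mul_I]
  module

/-- If the left factor is holomorphic, `∂̄` acts on the right factor only. -/
theorem pdbar_comp_of_left {f : ℂ → G →L[ℂ] X} {g : ℂ → E →L[ℂ] G} {z : ℂ}
    (hf : DifferentiableAt ℂ f z) (hg : DifferentiableAt ℝ g z) :
    pdbar (fun w => f w ∘L g w) z = f z ∘L pdbar g z := by
  rw [pdbar_comp (hf.restrictScalars ℝ) hg, pdbar_eq_zero hf, zero_comp, zero_add]

/-- If the right factor is holomorphic, `∂̄` acts on the left factor only. -/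
theorem pdbar_comp_of_right {f : ℂ → G →L[ℂ] X} {g : ℂ → E →L[ℂ] G} {z : ℂ}
    (hf : DifferentiableAt ℝ f z) (hg : DifferentiableAt ℂ g z) :
    pdbar (fun w => f w ∘L g w) z = pdbar f z ∘L g z := by
  rw [pdbar_comp hf (hg.restrictScalars ℝ), pdbar_eq_zero hg, comp_zero, add_zero]

theorem ContDiffAt.differentiableAt_pdbar {f : ℂ → E} {z : ℂ} (hf : ContDiffAt ℝ 2 f z) :
    DifferentiableAt ℝ (pdbar f) z := by
  have hd : DifferentiableAt ℝ (fderiv ℝ f) z :=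
    (hf.fderiv_right (m := 1) (by norm_num)).differentiableAt one_ne_zero
  have hv (v : ℂ) : DifferentiableAt ℝ (fun w => fderiv ℝ f w v) z :=
    hd.clm_apply (differentiableAt_const v)
  exact ((hv 1).add ((hv I).const_smul I)).const_smul (2⁻¹ : ℂ)

theorem ContDiffAt.clm_comp_restrictScalars {f : ℂ → G →L[ℂ] X} {g : ℂ → E →L[ℂ] G} {z : ℂ}
    {n : WithTop ℕ∞} (hf : ContDiffAt ℝ n f z) (hg : ContDiffAt ℝ n g z) :
    ContDiffAt ℝ n (fun w => f w ∘L g w) z :=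
  (((compL ℂ E G X).bilinearRestrictScalars ℝ).isBoundedBilinearMap.contDiff.contDiffAt).comp z
    (hf.prodMk hg)

end Wirtinger

section Adjoint

variable {H K : Type*} [NormedAddCommGroup H] [InnerProductSpace ℂ H] [CompleteSpace H]
  [NormedAddCommGroup K] [InnerProductSpace ℂ K] [CompleteSpace K]

/-- The adjoint as a real-linear continuous map. -/
noncomputable def adjointRealCLM : (K →L[ℂ] H) →L[ℝ] (H →L[ℂ] K) :=
  { toFun := fun T => adjoint T
    map_add' := map_add _
    map_smul' := fun r T => by
      change adjoint ((r : ℂ) • T) = (r : ℂ) • adjoint T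
      rw [map_smulₛₗ, conj_ofReal]
    cont := adjoint.continuous }

theorem contDiffAt_adjoint {F : ℂ → K →L[ℂ] H} {z : ℂ} {n : WithTop ℕ∞}
    (hF : ContDiffAt ℝ n F z) : ContDiffAt ℝ n (fun w => adjoint (F w)) z :=
  (adjointRealCLM (H := H) (K := K)).contDiff.contDiffAt.comp z hF

theorem pd_adjoint_eq_zero {F : ℂ → K →L[ℂ] H} {z : ℂ} (hF : DifferentiableAt ℂ F z) :
    pd (fun w => adjoint (F w)) z = 0 := by
  have hd := (adjointRealCLM (H := H) (K := K)).hasFDerivAt.comp z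
    (hF.restrictScalars ℝ).hasFDerivAt
  have hv (v : ℂ) :
      fderiv ℝ (fun w => adjoint (F w)) z v = (starRingEnd ℂ) v • adjoint (deriv F z) := by
    rw [show fderiv ℝ (fun w => adjoint (F w)) z = _ from hd.fderiv]
    change adjoint (fderiv ℝ F z v) = _
    rw [fderiv_real_apply_of_differentiableAt hF, map_smulₛₗ]
  simp only [pd, hv, smul_smul, conj_I, map_one, mul_neg, I_mul_I]
  module

end Adjoint

theorem stmt7
    {H K : Type*} [NormedAddCommGroup H] [InnerProductSpace ℂ H] [CompleteSpace H]
    [NormedAddCommGroup K] [InnerProductSpace ℂ K] [CompleteSpace K]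
    (Ω : Set ℂ) (hΩ : IsOpen Ω)
    (F : ℂ → K →L[ℂ] H)
    (hF : DifferentiableOn ℂ F Ω)
    (h : ℂ → K →L[ℂ] K)
    (hdef : ∀ z ∈ Ω, h z = ContinuousLinearMap.adjoint (F z) ∘L F z)
    (hinv : ∀ z ∈ Ω, IsUnit (h z))
    (hi : ℂ → K →L[ℂ] K) (hhi : ∀ z ∈ Ω, hi z = Ring.inverse (h z))
    (P : ℂ → H →L[ℂ] H)
    (hP : ∀ z ∈ Ω, P z = F z ∘L hi z ∘L ContinuousLinearMap.adjoint (F z))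
    (KP : ℂ → K →L[ℂ] K)
    (hKP : ∀ z ∈ Ω, KP z = -(pdbar (fun w => hi w * pd h w) z))
    : ∀ z ∈ Ω,
      (pdbar^[2] P) z * pd P z =
        F z ∘L ((-(pdbar KP z)) * hi z) ∘L ContinuousLinearMap.adjoint (F z) := by
  have hFd : ∀ w ∈ Ω, DifferentiableAt ℂ F w := fun w hw => hF.differentiableAt (hΩ.mem_nhds hw)
  have hF'd : ∀ w ∈ Ω, DifferentiableAt ℂ (deriv F) w := fun w hw =>
    (hF.deriv hΩ).differentiableAt (hΩ.mem_nhds hw)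
  have hFc : ∀ w ∈ Ω, ContDiffAt ℝ 2 F w := fun w hw =>
    ((hF.contDiffOn hΩ).contDiffAt (hΩ.mem_nhds hw)).restrict_scalars ℝ
  have hAc : ∀ w ∈ Ω, ContDiffAt ℝ 2 (fun w => adjoint (F w)) w := fun w hw =>
    contDiffAt_adjoint (hFc w hw)
  have ev : ∀ w ∈ Ω, ∀ᶠ u in nhds w, u ∈ Ω := fun w hw => hΩ.mem_nhds hw
  have hhc : ∀ w ∈ Ω, ContDiffAt ℝ 2 h w := fun w hw =>
    ((hAc w hw).clm_comp_restrictScalars (hFc w hw)).congr_of_eventuallyEq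
      ((ev w hw).mono fun u hu => hdef u hu)
  have hic : ∀ w ∈ Ω, ContDiffAt ℝ 2 hi w := fun w hw => by
    obtain ⟨x, hx⟩ := hinv w hw
    have hr : ContDiffAt ℝ 2 (Ring.inverse : (K →L[ℂ] K) → K →L[ℂ] K) (h w) :=
      hx ▸ (contDiffAt_ringInverse ℂ x).restrict_scalars ℝ
    exact (hr.comp w (hhc w hw)).congr_of_eventuallyEq ((ev w hw).mono fun u hu => hhi u hu)
  -- `B` is the left inverse `h⁻¹ F*` of `F`.
  set B : ℂ → H →L[ℂ] K := fun w => hi w ∘L adjoint (F w) with hB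
  have hBc : ∀ w ∈ Ω, ContDiffAt ℝ 2 B w := fun w hw =>
    (hic w hw).clm_comp_restrictScalars (hAc w hw)
  have hBd : ∀ w ∈ Ω, DifferentiableAt ℝ B w := fun w hw =>
    (hBc w hw).differentiableAt two_ne_zero
  have hQd : ∀ w ∈ Ω, DifferentiableAt ℝ (pdbar B) w := fun w hw =>
    (hBc w hw).differentiableAt_pdbar
  have hBF : ∀ w ∈ Ω, B w ∘L F w = 1 := fun w hw => by
    rw [hB, comp_assoc, ← hdef w hw, hhi w hw]
    exact Ring.inverse_mul_cancel _ (hinv w hw)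
  have hQF : ∀ w ∈ Ω, pdbar B w ∘L F w = 0 := fun w hw => by
    rw [← pdbar_comp_of_right (hBd w hw) (hFd w hw),
      pdbar_congr ((ev w hw).mono fun u hu => hBF u hu), pdbar_const]
  have hQ'F : ∀ w ∈ Ω, pdbar (pdbar B) w ∘L F w = 0 := fun w hw => by
    rw [← pdbar_comp_of_right (hQd w hw) (hFd w hw),
      pdbar_congr ((ev w hw).mono fun u hu => hQF u hu), pdbar_const]
  have hPB : ∀ w ∈ Ω, P =ᶠ[nhds w] fun u => F u ∘L B u := fun w hw =>
    (ev w hw).mono fun u hu => hP u hu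
  have hP1 : ∀ w ∈ Ω, pdbar P w = F w ∘L pdbar B w := fun w hw => by
    rw [pdbar_congr (hPB w hw), pdbar_comp_of_left (hFd w hw) (hBd w hw)]
  have hpdh : ∀ w ∈ Ω, pd h w = adjoint (F w) ∘L deriv F w := fun w hw => by
    rw [pd_congr ((ev w hw).mono fun u hu => hdef u hu),
      pd_comp ((hAc w hw).differentiableAt two_ne_zero) ((hFd w hw).restrictScalars ℝ),
      pd_adjoint_eq_zero (hFd w hw), pd_eq_deriv (hFd w hw), zero_comp, zero_add]
  have hK : ∀ w ∈ Ω, KP w = -(pdbar B w ∘L deriv F w) := fun w hw => by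
    have hcongr : (fun u => hi u * pd h u) =ᶠ[nhds w] fun u => B u ∘L deriv F u :=
      (ev w hw).mono fun u hu => by
        simp only [hpdh u hu, hB]
        rfl
    rw [hKP w hw, pdbar_congr hcongr, pdbar_comp_of_right (hBd w hw) (hF'd w hw)]
  intro z hz
  have hK1 : -pdbar KP z = pdbar (pdbar B) z ∘L deriv F z := by
    rw [pdbar_congr ((ev z hz).mono fun u hu => hK u hu), pdbar_neg,
      pdbar_comp_of_right (hQd z hz) (hF'd z hz), neg_neg]
  have hP2 : (pdbar^[2] P) z = F z ∘L pdbar (pdbar B) z := by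
    change pdbar (pdbar P) z = _
    rw [pdbar_congr ((ev z hz).mono fun u hu => hP1 u hu),
      pdbar_comp_of_left (hFd z hz) (hQd z hz)]
  have hPd : pd P z = deriv F z ∘L B z + F z ∘L pd B z := by
    rw [pd_congr (hPB z hz), pd_comp ((hFd z hz).restrictScalars ℝ) (hBd z hz),
      pd_eq_deriv (hFd z hz)]
  have hkill : pdbar (pdbar B) z ∘L (F z ∘L pd B z) = 0 := by
    rw [← comp_assoc, hQ'F z hz, zero_comp]
  rw [hP2, hPd, hK1]
  change (F z ∘L pdbar (pdbar B) z) ∘L (deriv F z ∘L B z + F z ∘L pd B z) = _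
  rw [comp_assoc, comp_add, hkill, add_zero]
  rfl
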